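/- Let G be a countable discrete amenable group, (V,‖·‖) a semi-normed real vector space, π: G → Isom(V) a uniformly bounded representation, and U a subspace of V contained in the ‖·‖-closure of L = span{v − π(g)v : v ∈ V, g ∈ G}. Then for every v ∈ V, limsup_{F→G} ‖A_F v‖ ≤ C_π · ‖v + U‖_U, where ‖v + U‖_U = inf_{u∈U} ‖v + u‖ is the quotient semi-norm. -/

import Mathlib

open scoped Pointwise
open Filter

/-- The collection `F(G)` of non-empty finite subsets of `G`. -/
def FinG (G : Type*) := {F : Finset G // F.Nonempty}

section Defs

variable {G : Type*} [Group G] [DecidableEq G]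

/-- `F` is `(K, δ)`-invariant: `|KF Δ F| ≤ δ|F|`. -/
def IsInv (K : Finset G) (δ : ℝ) (F : Finset G) : Prop :=
  ((symmDiff (K * F) F).card : ℝ) ≤ δ * (F.card : ℝ)

/-- `G` is amenable: for every `(K, δ)` there is a `(K, δ)`-invariant nonempty finite set. -/
def AmenableG (G : Type*) [Group G] [DecidableEq G] : Prop :=
  ∀ K : Finset G, K.Nonempty → ∀ δ : ℝ, 0 < δ →
    ∃ F : Finset G, F.Nonempty ∧ IsInv K δ F

/-- `limsup_{F → G} φ(F) = inf_{(K,δ)} sup {φ(F) : F is (K,δ)-invariant}` (in the extended reals). -/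
noncomputable def limsupG (φ : FinG G → ℝ) : EReal :=
  ⨅ (K : {K : Finset G // K.Nonempty}) (δ : {d : ℝ // 0 < d}),
    ⨆ F : {F : FinG G // IsInv K.1 δ.1 F.1}, (φ F.1 : EReal)

/-- `liminf_{F → G} φ(F) = sup_{(K,δ)} inf {φ(F) : F is (K,δ)-invariant}` (in the extended reals). -/
noncomputable def liminfG (φ : FinG G → ℝ) : EReal :=
  ⨆ (K : {K : Finset G // K.Nonempty}) (δ : {d : ℝ // 0 < d}),
    ⨅ F : {F : FinG G // IsInv K.1 δ.1 F.1}, (φ F.1 : EReal)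

/-- `lim_{F → G} φ(F) = L`. -/
def TendstoG (φ : FinG G → ℝ) (L : ℝ) : Prop :=
  ∀ ε : ℝ, 0 < ε → ∃ (K : Finset G) (δ : ℝ), K.Nonempty ∧ 0 < δ ∧
    ∀ F : FinG G, IsInv K δ F.1 → |φ F - L| < ε

/-- A (left) Følner sequence: `|F_n Δ g F_n| / |F_n| → 0` for every `g ∈ G`. -/
def FolnerSeq (F : ℕ → FinG G) : Prop :=
  ∀ g : G, Filter.Tendsto
    (fun n => ((symmDiff ((F n).1.image (fun h => g * h)) (F n).1).card : ℝ) / ((F n).1.card : ℝ))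
    Filter.atTop (nhds (0 : ℝ))

variable {V : Type*} [SeminormedAddCommGroup V] [NormedSpace ℝ V]

/-- The representation `π` is uniformly bounded with constant `C`. -/
def UnifBdd (π : G →* (V ≃L[ℝ] V)) (C : ℝ) : Prop :=
  ∀ (g : G) (v : V), ‖π g v‖ ≤ C * ‖v‖

/-- The representation `π` is isometric (`C_π = 1`). -/
def IsIsometric (π : G →* (V ≃L[ℝ] V)) : Prop :=
  ∀ (g : G) (v : V), ‖π g v‖ = ‖v‖

/-- The ergodic sum `S_F v = Σ_{g ∈ F} π(g⁻¹) v`. -/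
noncomputable def SF (π : G →* (V ≃L[ℝ] V)) (F : Finset G) (v : V) : V :=
  ∑ g ∈ F, π g⁻¹ v

/-- The ergodic average `A_F v = |F|⁻¹ • S_F v`. -/
noncomputable def AF (π : G →* (V ≃L[ℝ] V)) (F : Finset G) (v : V) : V :=
  (F.card : ℝ)⁻¹ • SF π F v

/-- Right translation `g • F = F g⁻¹` on nonempty finite subsets. -/
def rT (g : G) (F : FinG G) : FinG G :=
  ⟨F.1.image (fun h => h * g⁻¹), F.2.image (fun h => h * g⁻¹)⟩

/-- `G`-equivariance of a set map: `π(g) φ(F) = φ(F g⁻¹)`. -/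
def IsEquivariant (π : G →* (V ≃L[ℝ] V)) (φ : FinG G → V) : Prop :=
  ∀ (g : G) (F : FinG G), π g (φ F) = φ (rT g F)

/-- Boundedness of a set map: `sup_F ‖φ(F)‖/|F| < ∞`. -/
def IsBddMap (φ : FinG G → V) : Prop :=
  ∃ C : ℝ, ∀ F : FinG G, ‖φ F‖ ≤ C * (F.1.card : ℝ)

/-- Membership in the space `M` of bounded `G`-equivariant set maps. -/
def MemM (π : G →* (V ≃L[ℝ] V)) (φ : FinG G → V) : Prop :=
  IsBddMap φ ∧ IsEquivariant π φ

/-- The sup seminorm `|||φ|||_sup = sup_F ‖φ(F)‖/|F|`. -/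
noncomputable def supNorm (φ : FinG G → V) : ℝ :=
  ⨆ F : FinG G, ‖φ F‖ / (F.1.card : ℝ)

/-- The asymptotic seminorm `|||φ|||_G = limsup_{F → G} ‖φ(F)‖/|F|` (in the extended reals). -/
noncomputable def normG (φ : FinG G → V) : EReal :=
  limsupG (fun F => ‖φ F‖ / (F.1.card : ℝ))

/-- Union of nonempty finite subsets. -/
def unionF (E F : FinG G) : FinG G :=
  ⟨E.1 ∪ F.1, E.2.inl⟩

/-- Additive set maps: `φ(E ⊔ F) = φ(E) + φ(F)` for disjoint `E, F`. -/
def IsAdditiveMap (φ : FinG G → V) : Prop :=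
  ∀ E F : FinG G, Disjoint E.1 F.1 → φ (unionF E F) = φ E + φ F

/-- The additive set map `S(v)(F) = S_F v`. -/
noncomputable def Smap (π : G →* (V ≃L[ℝ] V)) (v : V) : FinG G → V :=
  fun F => SF π F.1 v

/-- The coboundary subspace `L_W = span{w − π(g)w : w ∈ W, g ∈ G}`. -/
def cobSpan (π : G →* (V ≃L[ℝ] V)) (W : Set V) : Submodule ℝ V :=
  Submodule.span ℝ {x | ∃ w ∈ W, ∃ g : G, x = w - π g w}

/-- The coboundary subspace `L = L_V`. -/
def cobL (π : G →* (V ≃L[ℝ] V)) : Submodule ℝ V :=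
  cobSpan π Set.univ

/-- The quotient seminorm `‖v + U‖_U = inf_{u ∈ U} ‖v + u‖`. -/
noncomputable def qnorm (U : Set V) (v : V) : ℝ :=
  ⨅ u : U, ‖v + u.1‖

/-- `v` is an additive realization of `φ`: `lim_{F→G} ‖φ(F)/|F| − A_F v‖ = 0`. -/
def IsRealization (π : G →* (V ≃L[ℝ] V)) (φ : FinG G → V) (v : V) : Prop :=
  TendstoG (fun F => ‖(F.1.card : ℝ)⁻¹ • φ F - AF π F.1 v‖) 0

/-- `φ` is asymptotically additive: `inf_{ψ ∈ M_⊕} |||φ − ψ|||_G = 0`. -/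
def AsympAdd (π : G →* (V ≃L[ℝ] V)) (φ : FinG G → V) : Prop :=
  (⨅ ψ : {ψ : FinG G → V // MemM π ψ ∧ IsAdditiveMap ψ}, normG (φ - ψ.1)) = (0 : EReal)

/-- `φ` is asymptotically additive relative to `W`. -/
def AsympAddRel (π : G →* (V ≃L[ℝ] V)) (W : Set V) (φ : FinG G → V) : Prop :=
  (⨅ w : W, limsupG (fun F => ‖(F.1.card : ℝ)⁻¹ • φ F - AF π F.1 w.1‖)) = (0 : EReal)

/-- The quotient norm on `M_⊕ / N_⊕`. -/
noncomputable def qMplusN (π : G →* (V ≃L[ℝ] V)) (ψ : FinG G → V) : ℝ :=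
  ⨅ η : {η : FinG G → V // MemM π η ∧ IsAdditiveMap η ∧ normG η = (0 : EReal)},
    supNorm (ψ + η.1)

end Defs

theorem symmDiff_mul_card_le {G : Type*} [Group G] [DecidableEq G] {K K' F : Finset G}
    (hK : K.Nonempty) (hKK' : K ⊆ K') :
    (symmDiff (K * F) F).card ≤ 2 * (symmDiff (K' * F) F).card := by
  obtain ⟨g, hg⟩ := hK
  have hgF : g • F ⊆ K * F := fun x hx => by
    obtain ⟨y, hy, rfl⟩ := Finset.mem_smul_finset.1 hx
    exact Finset.mul_mem_mul hg hy
  have hKF : K * F ⊆ K' * F := Finset.mul_subset_mul_right hKK'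
  have hright : ((K * F) \ F).card ≤ (symmDiff (K' * F) F).card :=
    Finset.card_le_card ((Finset.sdiff_subset_sdiff hKF subset_rfl).trans le_sup_left)
  have hleft : (F \ (K * F)).card ≤ (symmDiff (K' * F) F).card :=
    calc (F \ (K * F)).card
        ≤ (F \ (g • F)).card := Finset.card_le_card (Finset.sdiff_subset_sdiff subset_rfl hgF)
      _ = ((g • F) \ F).card :=
          Finset.card_sdiff_comm (Finset.card_smul_finset g F).symm
      _ ≤ (symmDiff (K' * F) F).card := Finset.card_le_card
          ((Finset.sdiff_subset_sdiff (hgF.trans hKF) subset_rfl).trans le_sup_left)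
  have hunion : (symmDiff (K * F) F).card ≤ ((K * F) \ F).card + (F \ (K * F)).card :=
    Finset.card_union_le _ _
  omega

theorem IsInv.of_subset {G : Type*} [Group G] [DecidableEq G] {K K' F : Finset G} {δ δ' : ℝ}
    (h : IsInv K' δ' F) (hK : K.Nonempty) (hKK' : K ⊆ K') (hδ : 2 * δ' ≤ δ) : IsInv K δ F := by
  have hcard : ((symmDiff (K * F) F).card : ℝ) ≤ 2 * (symmDiff (K' * F) F).card := by
    exact_mod_cast symmDiff_mul_card_le hK hKK'
  unfold IsInv at h ⊢
  nlinarith [mul_le_mul_of_nonneg_right hδ (Nat.cast_nonneg' (α := ℝ) F.card)]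

/-- The filter on `F(G)` generated by the sets of `(K, δ)`-invariant sets. -/
def invFilter (G : Type*) [Group G] [DecidableEq G] : Filter (FinG G) where
  sets := {s | ∃ (K : Finset G) (δ : ℝ), K.Nonempty ∧ 0 < δ ∧
    ∀ F : FinG G, IsInv K δ F.1 → F ∈ s}
  univ_sets := ⟨{1}, 1, Finset.singleton_nonempty 1, one_pos, fun _ _ => trivial⟩
  sets_of_superset := by
    rintro s t ⟨K, δ, hK, hδ, h⟩ hst
    exact ⟨K, δ, hK, hδ, fun F hF => hst (h F hF)⟩
  inter_sets := by
    rintro s t ⟨K, δ, hK, hδ, h⟩ ⟨K', δ', hK', hδ', h'⟩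
    refine ⟨K ∪ K', min δ δ' / 2, hK.mono Finset.subset_union_left, by positivity,
      fun F hF => ⟨h F (hF.of_subset hK Finset.subset_union_left ?_),
        h' F (hF.of_subset hK' Finset.subset_union_right ?_)⟩⟩
    · linarith [min_le_left δ δ']
    · linarith [min_le_right δ δ']

theorem eventually_invFilter {G : Type*} [Group G] [DecidableEq G] {p : FinG G → Prop} :
    (∀ᶠ F in invFilter G, p F) ↔ ∃ (K : Finset G) (δ : ℝ), K.Nonempty ∧ 0 < δ ∧
      ∀ F : FinG G, IsInv K δ F.1 → p F :=
  Iff.rfl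

theorem limsupG_le_of_eventually_le {G : Type*} [Group G] [DecidableEq G] {φ : FinG G → ℝ} {a : ℝ}
    (h : ∀ᶠ F in invFilter G, φ F ≤ a) : limsupG φ ≤ (a : EReal) := by
  obtain ⟨K, δ, hK, hδ, h⟩ := eventually_invFilter.1 h
  exact iInf_le_of_le ⟨K, hK⟩ (iInf_le_of_le ⟨δ, hδ⟩
    (iSup_le fun F => EReal.coe_le_coe_iff.2 (h F.1 F.2)))

section ErgodicAverages

variable {G : Type*} [Group G] {V : Type*} [SeminormedAddCommGroup V]
  [NormedSpace ℝ V] (π : G →* (V ≃L[ℝ] V))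

theorem AF_add (F : Finset G) (v w : V) : AF π F (v + w) = AF π F v + AF π F w := by
  simp [AF, SF, Finset.sum_add_distrib]

theorem AF_smul (F : Finset G) (c : ℝ) (v : V) : AF π F (c • v) = c • AF π F v := by
  simp only [AF, SF, map_smul, ← Finset.smul_sum]
  rw [smul_comm]

variable {π} {C : ℝ}

theorem UnifBdd.mul_norm_nonneg (hπ : UnifBdd π C) (v : V) : 0 ≤ C * ‖v‖ :=
  (norm_nonneg _).trans (hπ 1 v)

theorem UnifBdd.norm_SF_le (hπ : UnifBdd π C) (F : Finset G) (v : V) :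
    ‖SF π F v‖ ≤ F.card * (C * ‖v‖) := by
  simpa [SF] using norm_sum_le_of_le F fun g _ => hπ g⁻¹ v

theorem UnifBdd.norm_AF_le (hπ : UnifBdd π C) (F : Finset G) (v : V) :
    ‖AF π F v‖ ≤ C * ‖v‖ := by
  rw [AF, norm_smul, norm_inv, RCLike.norm_natCast]
  exact inv_mul_le_of_le_mul₀ (Nat.cast_nonneg _) (hπ.mul_norm_nonneg v) (hπ.norm_SF_le F v)

theorem SF_sub_map [DecidableEq G] (F : Finset G) (v : V) (g : G) :
    SF π F (v - π g v) = SF π (F \ (g⁻¹ • F)) v - SF π ((g⁻¹ • F) \ F) v := by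
  have hshift : SF π F (π g v) = SF π (g⁻¹ • F) v := by
    unfold SF
    rw [← Finset.image_smul, Finset.sum_image (MulAction.injective g⁻¹).injOn]
    refine Finset.sum_congr rfl fun h _ => ?_
    rw [smul_eq_mul, mul_inv_rev, inv_inv, map_mul]
    rfl
  have hsub : SF π F (v - π g v) = SF π F v - SF π F (π g v) := by
    simp [SF, Finset.sum_sub_distrib]
  rw [hsub, hshift]
  exact (Finset.sum_sdiff_sub_sum_sdiff).symm

theorem UnifBdd.norm_AF_sub_map_le [DecidableEq G] (hπ : UnifBdd π C) {F : Finset G} {δ : ℝ}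
    (v : V) (g : G) (hδ : 0 ≤ δ) (hF : IsInv {g⁻¹} δ F) :
    ‖AF π F (v - π g v)‖ ≤ δ * (C * ‖v‖) := by
  have hmul : ({g⁻¹} : Finset G) * F = g⁻¹ • F := Finset.singleton_mul g⁻¹
  have hcard : ((F \ (g⁻¹ • F)).card : ℝ) + ((g⁻¹ • F) \ F).card ≤ δ * F.card := by
    rw [IsInv, hmul, symmDiff_comm, symmDiff_def, Finset.sup_eq_union,
      Finset.card_union_of_disjoint disjoint_sdiff_sdiff] at hF
    exact_mod_cast hF
  rw [AF, norm_smul, norm_inv, RCLike.norm_natCast, SF_sub_map]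
  refine inv_mul_le_of_le_mul₀ (Nat.cast_nonneg _)
    (mul_nonneg hδ (hπ.mul_norm_nonneg v)) ?_
  refine (norm_sub_le _ _).trans ((add_le_add (hπ.norm_SF_le _ v) (hπ.norm_SF_le _ v)).trans ?_)
  nlinarith [mul_le_mul_of_nonneg_right hcard (hπ.mul_norm_nonneg v)]

theorem UnifBdd.tendsto_AF_sub_map [DecidableEq G] (hπ : UnifBdd π C) (v : V) (g : G) :
    Tendsto (fun F : FinG G => ‖AF π F.1 (v - π g v)‖) (invFilter G) (nhds 0) := by
  refine squeeze_zero_norm' (a := fun F : FinG G =>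
    ((symmDiff ({g⁻¹} * F.1) F.1).card : ℝ) / F.1.card * (C * ‖v‖)) ?_ ?_
  · refine Eventually.of_forall fun F => ?_
    rw [norm_norm]
    refine hπ.norm_AF_sub_map_le v g (by positivity) ?_
    have : (F.1.card : ℝ) ≠ 0 := by exact_mod_cast F.2.card_ne_zero
    rw [IsInv, div_mul_cancel₀ _ this]
  · rw [← zero_mul (C * ‖v‖)]
    refine Tendsto.mul_const _ (tendsto_order.2 ⟨fun a ha => ?_, fun a ha => ?_⟩)
    · exact Eventually.of_forall fun F => ha.trans_le (by positivity)
    · refine eventually_invFilter.2 ⟨{g⁻¹}, a / 2, Finset.singleton_nonempty _, half_pos ha,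
        fun F hF => ?_⟩
      have : (0 : ℝ) < F.1.card := by exact_mod_cast F.2.card_pos
      exact ((div_le_iff₀ this).2 hF).trans_lt (half_lt_self ha)

theorem UnifBdd.tendsto_AF_of_mem_cobL [DecidableEq G] (hπ : UnifBdd π C) {v : V}
    (hv : v ∈ cobL π) : Tendsto (fun F : FinG G => ‖AF π F.1 v‖) (invFilter G) (nhds 0) := by
  induction hv using Submodule.span_induction with
  | mem x hx =>
    obtain ⟨w, -, g, rfl⟩ := hx
    exact hπ.tendsto_AF_sub_map w g
  | zero => simpa [AF, SF] using tendsto_const_nhds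
  | add x y _ _ hx hy =>
    refine squeeze_zero (fun _ => norm_nonneg _) (fun F => ?_) (by simpa using hx.add hy)
    rw [AF_add]
    exact norm_add_le _ _
  | smul c x _ hx =>
    simp only [AF_smul, norm_smul]
    simpa using hx.const_mul ‖c‖

theorem UnifBdd.tendsto_AF_of_mem_closure_cobL [DecidableEq G] (hπ : UnifBdd π C) {v : V}
    (hv : v ∈ closure (cobL π : Set V)) :
    Tendsto (fun F : FinG G => ‖AF π F.1 v‖) (invFilter G) (nhds 0) := by
  refine tendsto_order.2 ⟨fun a ha => Eventually.of_forall fun F => ha.trans_le (norm_nonneg _),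
    fun ε hε => ?_⟩
  have hC : 0 < |C| + 1 := by positivity
  obtain ⟨w, hw, hvw⟩ := Metric.mem_closure_iff.1 hv (ε / 2 / (|C| + 1)) (by positivity)
  rw [dist_eq_norm, lt_div_iff₀ hC] at hvw
  filter_upwards [(hπ.tendsto_AF_of_mem_cobL hw).eventually_lt_const (half_pos hε)] with F hF
  have hsplit : AF π F.1 v = AF π F.1 (v - w) + AF π F.1 w := by
    rw [← AF_add, sub_add_cancel]
  have hdiff := hπ.norm_AF_le F.1 (v - w)
  have hnorm := norm_add_le (AF π F.1 (v - w)) (AF π F.1 w)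
  rw [← hsplit] at hnorm
  nlinarith [mul_le_mul_of_nonneg_right (le_abs_self C) (norm_nonneg (v - w)),
    norm_nonneg (v - w)]

theorem UnifBdd.exists_mul_norm_add_le (hπ : UnifBdd π C) (U : Submodule ℝ V) (v : V) {ε : ℝ}
    (hε : 0 < ε) : ∃ u ∈ U, C * ‖v + u‖ ≤ C * qnorm (U : Set V) v + ε := by
  rcases le_or_gt 0 C with hC | hC
  · have hlt : (⨅ u : (U : Set V), ‖v + u.1‖) < qnorm (U : Set V) v + ε / (C + 1) :=
      lt_add_of_pos_right _ (by positivity)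
    obtain ⟨u, hu⟩ := exists_lt_of_ciInf_lt hlt
    refine ⟨u, u.2, (mul_le_mul_of_nonneg_left hu.le hC).trans ?_⟩
    have : C * (ε / (C + 1)) ≤ ε := by
      rw [mul_div_assoc', div_le_iff₀ (by positivity)]
      nlinarith
    linarith
  · have hzero (w : V) : ‖w‖ = 0 := by
      nlinarith [hπ.mul_norm_nonneg w, norm_nonneg w]
    refine ⟨0, U.zero_mem, ?_⟩
    simp [qnorm, hzero, hε.le]

end ErgodicAverages

theorem statement3 {G : Type*} [Group G] [DecidableEq G] [Countable G]
    {V : Type*} [SeminormedAddCommGroup V] [NormedSpace ℝ V]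
    (hG : AmenableG G) (π : G →* (V ≃L[ℝ] V)) (C : ℝ) (hπ : UnifBdd π C)
    (U : Submodule ℝ V) (hU : (U : Set V) ⊆ closure (cobL π : Set V)) (v : V) :
    limsupG (fun F => ‖AF π F.1 v‖) ≤ ((C * qnorm (U : Set V) v : ℝ) : EReal) := by
  refine EReal.le_of_forall_lt_iff_le.1 fun a ha => limsupG_le_of_eventually_le ?_
  have ha := sub_pos.2 (EReal.coe_lt_coe_iff.1 ha)
  obtain ⟨u, hu, hle⟩ := hπ.exists_mul_norm_add_le U v (half_pos ha)
  filter_upwards [(hπ.tendsto_AF_of_mem_closure_cobL (hU hu)).eventually_lt_const (half_pos ha)]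
    with F hF
  have hsplit : AF π F.1 v = AF π F.1 (v + u) - AF π F.1 u := by
    rw [AF_add, add_sub_cancel_right]
  have hsum := hπ.norm_AF_le F.1 (v + u)
  have hnorm := norm_sub_le (AF π F.1 (v + u)) (AF π F.1 u)
  rw [← hsplit] at hnorm
  linarith
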